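/- Let $d > 2\alpha > 0$ and let $x, y, z \in \mathbb{R}^d$ be distinct points with $\|x - y\| = d_{\min}$ the minimum and $\|x - z\| = d_{\max}$ the maximum of the three pairwise distances. Then the integral $\int_{\mathbb{R}^d} \|x - w\|^{-d+\alpha} \|y - w\|^{-d+\alpha} \|z - w\|^{-d+\alpha}\, dw$ is finite and comparable, up to multiplicative constants depending only on $d$ and $\alpha$, to $d_{\min}^{-d + 2\alpha}\, d_{\max}^{-d + \alpha}$. -/

import Mathlib

open Real Filter MeasureTheory

/-- Radial majorant. -/
noncomputable def radG (p s r : ℝ) : ℝ := r ^ p * (max s r) ^ p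

lemma radG_nonneg {p s r : ℝ} (hr : 0 ≤ r) : 0 ≤ radG p s r := by
  unfold radG
  have : 0 ≤ max s r := le_max_of_le_right hr
  positivity

lemma radG_integrable_one (d : ℕ) (α : ℝ) (hα : 0 < α) (hd : 2 * α < d) :
    Integrable (fun u : EuclideanSpace ℝ (Fin d) => radG (-(d:ℝ) + α) 1 ‖u‖) := by
  have hd0 : 0 < d := by
    have : (0:ℝ) < d := by linarith
    exact_mod_cast this
  haveI : Nonempty (Fin d) := ⟨⟨0, hd0⟩⟩
  rw [integrable_fun_norm_addHaar volume (f := fun r => radG (-(d:ℝ) + α) 1 r)]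
  rw [finrank_euclideanSpace_fin]
  have hcast : ((d - 1 : ℕ) : ℝ) = (d:ℝ) - 1 := by
    rw [Nat.cast_sub hd0]; simp
  have hU : Set.Ioi (0:ℝ) = Set.Ioc 0 1 ∪ Set.Ioi 1 :=
    (Set.Ioc_union_Ioi_eq_Ioi zero_le_one).symm
  rw [hU]
  apply IntegrableOn.union
  · have h1 : IntegrableOn (fun t : ℝ => t ^ (α - 1)) (Set.Ioc 0 1) := by
      rw [← intervalIntegrable_iff_integrableOn_Ioc_of_le zero_le_one]
      exact intervalIntegral.intervalIntegrable_rpow' (by linarith)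
    refine h1.congr_fun ?_ measurableSet_Ioc
    intro t ht
    simp only [radG, smul_eq_mul]
    rw [max_eq_left ht.2, one_rpow, mul_one, ← rpow_natCast, ← rpow_add ht.1, hcast]
    congr 1; ring
  · have h1 : IntegrableOn (fun t : ℝ => t ^ (-(d:ℝ) + 2 * α - 1)) (Set.Ioi 1) :=
      integrableOn_Ioi_rpow_of_lt (by linarith) one_pos
    refine h1.congr_fun ?_ measurableSet_Ioi
    intro t ht
    have ht' : (1:ℝ) < t := ht
    have ht0 : 0 < t := by linarith
    simp only [radG, smul_eq_mul]
    rw [max_eq_right ht'.le, ← rpow_natCast, ← rpow_add ht0, ← rpow_add ht0, hcast]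
    congr 1; ring

lemma radG_scale {p s r : ℝ} (hs : 0 < s) (hr : 0 ≤ r) :
    radG p s r = s ^ (2 * p) * radG p 1 (s⁻¹ * r) := by
  unfold radG
  have h1 : max s r = s * max 1 (s⁻¹ * r) := by
    rw [mul_max_of_nonneg _ _ hs.le]; congr 1
    · ring
    · field_simp
  have h2 : r ^ p = s ^ p * (s⁻¹ * r) ^ p := by
    rw [← mul_rpow hs.le (by positivity)]; congr 1; field_simp
  rw [h1, mul_rpow hs.le (by positivity), h2, two_mul, rpow_add hs]
  ring

lemma radG_integrable (d : ℕ) (α : ℝ) (hα : 0 < α) (hd : 2 * α < d) {s : ℝ} (hs : 0 < s)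
    (x : EuclideanSpace ℝ (Fin d)) :
    Integrable (fun w : EuclideanSpace ℝ (Fin d) => radG (-(d:ℝ) + α) s ‖x - w‖) := by
  have h0 := ((radG_integrable_one d α hα hd).comp_smul
    (inv_ne_zero hs.ne')).const_mul (s ^ (2 * (-(d:ℝ) + α)))
  have h1 := h0.comp_sub_left x
  refine h1.congr (Eventually.of_forall fun w => ?_)
  simp only
  rw [radG_scale hs (norm_nonneg _), norm_smul, Real.norm_of_nonneg (inv_nonneg.2 hs.le)]

lemma radG_integral (d : ℕ) (α : ℝ) {s : ℝ} (hs : 0 < s)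
    (x : EuclideanSpace ℝ (Fin d)) :
    ∫ w : EuclideanSpace ℝ (Fin d), radG (-(d:ℝ) + α) s ‖x - w‖ =
      s ^ (-(d:ℝ) + 2 * α) * ∫ u : EuclideanSpace ℝ (Fin d), radG (-(d:ℝ) + α) 1 ‖u‖ := by
  rw [integral_sub_left_eq_self (fun u : EuclideanSpace ℝ (Fin d) =>
    radG (-(d:ℝ) + α) s ‖u‖) volume x]
  have h : ∀ u : EuclideanSpace ℝ (Fin d), radG (-(d:ℝ) + α) s ‖u‖ =
      s ^ (2 * (-(d:ℝ) + α)) * radG (-(d:ℝ) + α) 1 ‖s⁻¹ • u‖ := by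
    intro u
    rw [radG_scale hs (norm_nonneg _), norm_smul, Real.norm_of_nonneg (inv_nonneg.2 hs.le)]
  simp_rw [h]
  rw [integral_const_mul, Measure.integral_comp_smul volume
    (fun u : EuclideanSpace ℝ (Fin d) => radG (-(d:ℝ) + α) 1 ‖u‖), finrank_euclideanSpace_fin,
    smul_eq_mul, ← mul_assoc]
  congr 1
  rw [inv_pow, inv_inv, abs_of_pos (by positivity), ← rpow_natCast, ← rpow_add hs]
  congr 1; ring

lemma pointwise_bound {p a b c m M : ℝ} (hp : p ≤ 0) (ha : 0 ≤ a) (hb : 0 ≤ b) (hc : 0 ≤ c)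
    (hm : 0 < m) (hmM : m ≤ M) (h1 : m ≤ a + b) (h2 : M ≤ a + c) (h3 : M ≤ 2 * (b + c)) :
    a ^ p * b ^ p * c ^ p ≤
      (M / 4) ^ p * (radG p (m / 4) a + radG p (m / 4) b + radG p (m / 4) c) := by
  have hM : 0 < M := by linarith
  have hga := radG_nonneg (p := p) (s := m / 4) ha
  have hgb := radG_nonneg (p := p) (s := m / 4) hb
  have hgc := radG_nonneg (p := p) (s := m / 4) hc
  have hM4 : 0 ≤ (M / 4) ^ p := by positivity
  have hap : 0 ≤ a ^ p := rpow_nonneg ha _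
  have hbp : 0 ≤ b ^ p := rpow_nonneg hb _
  have hcp : 0 ≤ c ^ p := rpow_nonneg hc _
  have key : ∀ u v t : ℝ, 0 ≤ u → 0 ≤ v → 0 ≤ t → M / 4 ≤ t → m / 4 ≤ v → u ≤ v →
      u ^ p * v ^ p * t ^ p ≤ (M / 4) ^ p * radG p (m / 4) u := by
    intro u v t hu hv ht h4 h5 h6
    have e1 : t ^ p ≤ (M / 4) ^ p := rpow_le_rpow_of_nonpos (by positivity) h4 hp
    have e2 : v ^ p ≤ (max (m / 4) u) ^ p :=
      rpow_le_rpow_of_nonpos (lt_max_of_lt_left (by positivity)) (max_le h5 h6) hp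
    have : 0 ≤ max (m / 4) u := le_max_of_le_right hu
    unfold radG
    calc u ^ p * v ^ p * t ^ p ≤ u ^ p * (max (m / 4) u) ^ p * (M / 4) ^ p := by gcongr
      _ = _ := by ring
  by_cases hcM : M / 4 ≤ c
  · rcases le_total a b with hab | hab
    · have := key a b c ha hb hc hcM (by linarith) hab
      nlinarith [mul_nonneg hM4 hgb, mul_nonneg hM4 hgc]
    · have := key b a c hb ha hc hcM (by linarith) hab
      nlinarith [mul_nonneg hM4 hga, mul_nonneg hM4 hgc]
  · push Not at hcM
    have := key c b a hc hb ha (by linarith) (by linarith) (by linarith)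
    nlinarith [mul_nonneg hM4 hga, mul_nonneg hM4 hgb]

theorem three_point_tree_graph_integral (d : ℕ) (α : ℝ)
    (hα : 0 < α) (hd : 2 * α < d) :
    ∃ c C : ℝ, 0 < c ∧ 0 < C ∧
      ∀ x y z : EuclideanSpace ℝ (Fin d),
        x ≠ y → y ≠ z → x ≠ z →
        ‖x - y‖ ≤ ‖y - z‖ → ‖x - y‖ ≤ ‖x - z‖ → ‖y - z‖ ≤ ‖x - z‖ →
        Integrable (fun w => ‖x - w‖ ^ (-(d:ℝ) + α) * ‖y - w‖ ^ (-(d:ℝ) + α) *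
            ‖z - w‖ ^ (-(d:ℝ) + α)) ∧
        c * (‖x - y‖ ^ (-(d:ℝ) + 2 * α) * ‖x - z‖ ^ (-(d:ℝ) + α)) ≤
          (∫ w, ‖x - w‖ ^ (-(d:ℝ) + α) * ‖y - w‖ ^ (-(d:ℝ) + α) *
            ‖z - w‖ ^ (-(d:ℝ) + α)) ∧
        (∫ w, ‖x - w‖ ^ (-(d:ℝ) + α) * ‖y - w‖ ^ (-(d:ℝ) + α) *
            ‖z - w‖ ^ (-(d:ℝ) + α)) ≤
          C * (‖x - y‖ ^ (-(d:ℝ) + 2 * α) * ‖x - z‖ ^ (-(d:ℝ) + α)) := by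
  have hd0 : 0 < d := by
    have : (0:ℝ) < d := by linarith
    exact_mod_cast this
  haveI : Nonempty (Fin d) := ⟨⟨0, hd0⟩⟩
  set p : ℝ := -(d:ℝ) + α with hp
  have hp0 : p ≤ 0 := by linarith
  set q : ℝ := -(d:ℝ) + 2 * α with hq
  set K : ℝ := ∫ u : EuclideanSpace ℝ (Fin d), radG p 1 ‖u‖ with hK
  have hK0 : 0 ≤ K := integral_nonneg fun u => radG_nonneg (norm_nonneg _)
  set V : ℝ := (volume : Measure (EuclideanSpace ℝ (Fin d))).real (Metric.ball 0 1) with hV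
  have hV0 : 0 < V :=
    ENNReal.toReal_pos (Metric.measure_ball_pos _ _ one_pos).ne' measure_ball_lt_top.ne
  refine ⟨2 ^ p * 2 ^ p * V, (4⁻¹) ^ p * (4⁻¹) ^ q * (3 * K) + 1, by positivity, by positivity, ?_⟩
  intro x y z hxy hyz hxz h1 h2 h3
  have hm : 0 < ‖x - y‖ := norm_pos_iff.2 (sub_ne_zero.2 hxy)
  have hM : 0 < ‖x - z‖ := norm_pos_iff.2 (sub_ne_zero.2 hxz)
  set m := ‖x - y‖ with hmdef
  set M := ‖x - z‖ with hMdef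
  have hm4 : 0 < m / 4 := by positivity
  have tri : ∀ a b c : EuclideanSpace ℝ (Fin d), ‖a - b‖ ≤ ‖a - c‖ + ‖b - c‖ := by
    intro a b c
    rw [norm_sub_rev b c]
    exact norm_sub_le_norm_sub_add_norm_sub a c b
  have hpt : ∀ w, ‖x - w‖ ^ p * ‖y - w‖ ^ p * ‖z - w‖ ^ p ≤ (M / 4) ^ p *
      (radG p (m / 4) ‖x - w‖ + radG p (m / 4) ‖y - w‖ + radG p (m / 4) ‖z - w‖) := by
    intro w
    have hz := tri x z y
    have hz2 : ‖z - y‖ = ‖y - z‖ := norm_sub_rev _ _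
    have := tri y z w
    exact pointwise_bound hp0 (norm_nonneg _) (norm_nonneg _) (norm_nonneg _) hm h2
      (tri x y w) (tri x z w) (by linarith)
  have hnn : ∀ w, 0 ≤ ‖x - w‖ ^ p * ‖y - w‖ ^ p * ‖z - w‖ ^ p := fun w => by positivity
  have ix := radG_integrable d α hα hd hm4 x
  have iy := radG_integrable d α hα hd hm4 y
  have iz := radG_integrable d α hα hd hm4 z
  have iG := ((ix.add iy).add iz).const_mul ((M / 4) ^ p)
  have hint : Integrable (fun w => ‖x - w‖ ^ p * ‖y - w‖ ^ p * ‖z - w‖ ^ p) := by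
    refine iG.mono' ?_ (Eventually.of_forall fun w => ?_)
    · have : Measurable (fun w => ‖x - w‖ ^ p * ‖y - w‖ ^ p * ‖z - w‖ ^ p) := by fun_prop
      exact this.aestronglyMeasurable
    · rw [Real.norm_of_nonneg (hnn w)]
      exact hpt w
  refine ⟨hint, ?_, ?_⟩
  · have hvol : (volume : Measure (EuclideanSpace ℝ (Fin d))).real (Metric.ball x m \ {x})
        = m ^ (d:ℝ) * V := by
      rw [measureReal_def, measure_sdiff_null (measure_singleton x),
        Measure.addHaar_ball volume x hm.le, ENNReal.toReal_mul, finrank_euclideanSpace_fin,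
        ENNReal.toReal_ofReal (by positivity), rpow_natCast, hV, measureReal_def]
    have hlow : ∀ w ∈ Metric.ball x m \ {x}, m ^ p * (2 * m) ^ p * (2 * M) ^ p ≤
        ‖x - w‖ ^ p * ‖y - w‖ ^ p * ‖z - w‖ ^ p := by
      rintro w ⟨hw, hwx⟩
      have hwm : ‖x - w‖ < m := by
        rw [Metric.mem_ball, dist_comm, dist_eq_norm] at hw; exact hw
      have a0 : 0 < ‖x - w‖ := norm_pos_iff.2 (sub_ne_zero.2 (Ne.symm hwx))
      have t1 := tri x y w
      have t2 := tri x z w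
      have t3 := tri y w x
      have t4 := tri z w x
      rw [norm_sub_rev w x] at t3 t4
      rw [norm_sub_rev y x] at t3
      rw [norm_sub_rev z x] at t4
      have e1 : m ^ p ≤ ‖x - w‖ ^ p := rpow_le_rpow_of_nonpos a0 hwm.le hp0
      have e2 : (2 * m) ^ p ≤ ‖y - w‖ ^ p :=
        rpow_le_rpow_of_nonpos (by linarith) (by linarith) hp0
      have e3 : (2 * M) ^ p ≤ ‖z - w‖ ^ p :=
        rpow_le_rpow_of_nonpos (by linarith) (by linarith) hp0
      gcongr
    have hfin : volume (Metric.ball x m \ {x}) ≠ ⊤ :=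
      (lt_of_le_of_lt (measure_mono Set.diff_subset) measure_ball_lt_top).ne
    have hA := setIntegral_ge_of_const_le_real
      (measurableSet_ball.diff (measurableSet_singleton x)) hfin hlow hint.integrableOn
    have hB := setIntegral_le_integral (s := Metric.ball x m \ {x}) hint
      (Eventually.of_forall hnn)
    refine le_trans (le_of_eq ?_) (hA.trans hB)
    have hqe : m ^ q = m ^ p * m ^ p * m ^ (d:ℝ) := by
      rw [← rpow_add hm, ← rpow_add hm]; congr 1; rw [hq, hp]; ring
    rw [hvol, mul_rpow zero_le_two hm.le, mul_rpow zero_le_two hM.le, hqe]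
    ring
  · have hle := integral_mono hint iG hpt
    refine hle.trans ?_
    rw [integral_const_mul]
    have e : ∫ w, ((fun w => radG p (m / 4) ‖x - w‖) + (fun w => radG p (m / 4) ‖y - w‖) +
        (fun w => radG p (m / 4) ‖z - w‖)) w = 3 * ((m / 4) ^ q * K) := by
      rw [integral_add' (ix.add iy) iz, integral_add' ix iy, radG_integral d α hm4,
        radG_integral d α hm4, radG_integral d α hm4]
      ring
    have e2 := congrArg (fun t => (M / 4) ^ p * t) e
    refine (le_of_eq e2).trans ?_
    rw [div_eq_mul_inv, div_eq_mul_inv, mul_rpow hM.le (by norm_num),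
      mul_rpow hm.le (by norm_num)]
    have : 0 ≤ m ^ q * M ^ p := by positivity
    nlinarith
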